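/- Let T ≥ 1 be an integer and let v₁, …, v_T be independent, identically distributed real random variables with E[v_t] = 0 and E[v_t⁴] < ∞, and write μ₂ = E[v_t²] and μ₄ = E[v_t⁴]. Define the within residuals ε_t^w = v_t − (1/T)·Σ_{s=1}^T v_s. Then for each t, E[(ε_t^w)⁴] = ((T−1)(T²−3T+3)/T³)·μ₄ + 3·((T−1)(2T−3)/T³)·μ₂². -/

import Mathlib

open MeasureTheory ProbabilityTheory

section FourthMoments

variable {Ω : Type*} [MeasurableSpace Ω] {μ : Measure Ω}

lemma MeasureTheory.MemLp.integrable_pow_of_le_four [IsFiniteMeasure μ] {X : Ω → ℝ}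
    (hX : MemLp X 4 μ) {k : ℕ} (hk : k ≤ 4) : Integrable (fun ω => X ω ^ k) μ := by
  have hXk : MemLp X k μ := hX.mono_exponent (by exact_mod_cast hk)
  refine (integrable_norm_iff (hX.aestronglyMeasurable.pow k)).1 ?_
  simpa [norm_pow] using hXk.integrable_norm_pow'

lemma ProbabilityTheory.IndepFun.pow_pow {X Y : Ω → ℝ} (h : X ⟂ᵢ[μ] Y) (j k : ℕ) :
    (fun ω => X ω ^ j) ⟂ᵢ[μ] (fun ω => Y ω ^ k) :=
  h.comp (φ := fun x : ℝ => x ^ j) (ψ := fun y : ℝ => y ^ k) (by fun_prop) (by fun_prop)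

lemma ProbabilityTheory.IndepFun.integrable_pow_mul_pow [IsFiniteMeasure μ] {X Y : Ω → ℝ}
    (h : X ⟂ᵢ[μ] Y) (hX : MemLp X 4 μ) (hY : MemLp Y 4 μ) {j k : ℕ} (hj : j ≤ 4) (hk : k ≤ 4) :
    Integrable (fun ω => X ω ^ j * Y ω ^ k) μ :=
  (h.pow_pow j k).integrable_mul (hX.integrable_pow_of_le_four hj)
    (hY.integrable_pow_of_le_four hk)

lemma ProbabilityTheory.IndepFun.integral_pow_mul_pow [IsFiniteMeasure μ] {X Y : Ω → ℝ}
    (h : X ⟂ᵢ[μ] Y) (hX : MemLp X 4 μ) (hY : MemLp Y 4 μ) {j k : ℕ} (hj : j ≤ 4) (hk : k ≤ 4) :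
    ∫ ω, X ω ^ j * Y ω ^ k ∂μ = (∫ ω, X ω ^ j ∂μ) * ∫ ω, Y ω ^ k ∂μ :=
  (h.pow_pow j k).integral_fun_mul_eq_mul_integral
    (hX.integrable_pow_of_le_four hj).aestronglyMeasurable
    (hY.integrable_pow_of_le_four hk).aestronglyMeasurable

/-- The binomial formula for moments of order at most four of a sum of two independent
variables. -/
lemma ProbabilityTheory.IndepFun.integral_add_pow [IsFiniteMeasure μ] {X Y : Ω → ℝ}
    (h : X ⟂ᵢ[μ] Y) (hX : MemLp X 4 μ) (hY : MemLp Y 4 μ) {n : ℕ} (hn : n ≤ 4) :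
    ∫ ω, (X ω + Y ω) ^ n ∂μ = ∑ m ∈ Finset.range (n + 1),
      (∫ ω, X ω ^ m ∂μ) * (∫ ω, Y ω ^ (n - m) ∂μ) * n.choose m := by
  simp_rw [add_pow]
  rw [integral_finsetSum]
  · refine Finset.sum_congr rfl fun m hm => ?_
    have hm' : m < n + 1 := Finset.mem_range.1 hm
    rw [integral_mul_const, h.integral_pow_mul_pow hX hY (by omega) (by omega)]
  · intro m hm
    have hm' : m < n + 1 := Finset.mem_range.1 hm
    exact (h.integrable_pow_mul_pow hX hY (by omega) (by omega)).mul_const _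

variable [IsProbabilityMeasure μ] {ι : Type*} {X : ι → Ω → ℝ}

/-- The first, second and fourth moments of a sum of independent centred variables. -/
lemma ProbabilityTheory.iIndepFun.moments_sum_of_centered (hindep : iIndepFun X μ)
    (hmeas : ∀ i, Measurable (X i)) (hX : ∀ i, MemLp (X i) 4 μ)
    (hmean : ∀ i, ∫ ω, X i ω ∂μ = 0) (s : Finset ι) :
    ∫ ω, ∑ i ∈ s, X i ω ∂μ = 0 ∧
    ∫ ω, (∑ i ∈ s, X i ω) ^ 2 ∂μ = ∑ i ∈ s, ∫ ω, X i ω ^ 2 ∂μ ∧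
    ∫ ω, (∑ i ∈ s, X i ω) ^ 4 ∂μ = ∑ i ∈ s, ∫ ω, X i ω ^ 4 ∂μ
      + 3 * ((∑ i ∈ s, ∫ ω, X i ω ^ 2 ∂μ) ^ 2 - ∑ i ∈ s, (∫ ω, X i ω ^ 2 ∂μ) ^ 2) := by
  classical
  induction s using Finset.induction_on with
  | empty => simp
  | insert i s his ih =>
    obtain ⟨ih1, ih2, ih4⟩ := ih
    have hS : MemLp (fun ω => ∑ j ∈ s, X j ω) 4 μ := memLp_finsetSum s fun j _ => hX j
    have hind : X i ⟂ᵢ[μ] (fun ω => ∑ j ∈ s, X j ω) := by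
      have := (hindep.indepFun_finsetSum_of_notMem hmeas his).symm
      rwa [show (∑ j ∈ s, X j) = fun ω => ∑ j ∈ s, X j ω by ext; simp] at this
    have h1 := hind.integral_add_pow (hX i) hS (n := 1) (by norm_num)
    have h2 := hind.integral_add_pow (hX i) hS (n := 2) (by norm_num)
    have h4 := hind.integral_add_pow (hX i) hS (n := 4) le_rfl
    simp only [Finset.sum_range_succ, Finset.sum_range_zero] at h1 h2 h4
    simp [ih1, hmean] at h1
    simp [ih1, ih2, hmean] at h2
    simp [ih1, ih2, ih4, hmean, show Nat.choose 4 2 = 6 from rfl] at h4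
    simp only [Finset.sum_insert his]
    refine ⟨h1, by rw [h2]; ring, ?_⟩
    rw [h4]
    ring

end FourthMoments

/-- Fourth within-moment identity: for i.i.d. mean-zero `v₁,…,v_T` with
`E[v_t²] = μ₂` and `E[v_t⁴] = μ₄ < ∞`, the within residual `ε_t^w = v_t − v̄`
satisfies `E[(ε_t^w)⁴] = ((T−1)(T²−3T+3)/T³)·μ₄ + 3((T−1)(2T−3)/T³)·μ₂²`. -/
theorem within_fourth_moment
    {Ω : Type*} [MeasurableSpace Ω] (μ : Measure Ω) [IsProbabilityMeasure μ]
    (T : ℕ) (hT : 1 ≤ T) (v : Fin T → Ω → ℝ)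
    (hmeas : ∀ t, Measurable (v t))
    (hindep : iIndepFun v μ)
    (hident : ∀ s t : Fin T, IdentDistrib (v s) (v t) μ μ)
    (hint1 : ∀ t, Integrable (v t) μ)
    (hmean : ∀ t, ∫ ω, v t ω ∂μ = 0)
    (μ2 μ4 : ℝ)
    (hint4 : ∀ t, Integrable (fun ω => (v t ω) ^ 4) μ)
    (hμ2 : ∀ t, ∫ ω, (v t ω) ^ 2 ∂μ = μ2)
    (hμ4 : ∀ t, ∫ ω, (v t ω) ^ 4 ∂μ = μ4)
    (t : Fin T) :
    ∫ ω, (v t ω - (1 / (T : ℝ)) * ∑ s, v s ω) ^ 4 ∂μ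
      = ((T : ℝ) - 1) * ((T : ℝ) ^ 2 - 3 * T + 3) / (T : ℝ) ^ 3 * μ4
        + 3 * (((T : ℝ) - 1) * (2 * T - 3) / (T : ℝ) ^ 3) * μ2 ^ 2 := by
  have hT0 : (T : ℝ) ≠ 0 := by exact_mod_cast (by omega : T ≠ 0)
  set a : Fin T → ℝ := fun s => (if s = t then 1 else 0) - 1 / (T : ℝ) with ha
  have hv : ∀ s, MemLp (v s) 4 μ := fun s => by
    refine (integrable_norm_rpow_iff (hmeas s).aestronglyMeasurable (by norm_num)
      (by norm_num)).1 ?_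
    have := (hint4 s).norm
    simpa [norm_pow] using this
  have hresidual : ∀ ω, v t ω - (1 / (T : ℝ)) * ∑ s, v s ω = ∑ s, a s * v s ω := fun ω => by
    simp [ha, sub_mul, Finset.sum_sub_distrib, Finset.mul_sum]
  have hindep' : iIndepFun (fun s ω => a s * v s ω) μ :=
    hindep.comp (fun s x => a s * x) fun s => by fun_prop
  have hsum2 : ∑ s, a s ^ 2 = ((T : ℝ) - 1) / T := by
    have h : ∀ s, a s ^ 2 = (if s = t then 1 - 2 / (T : ℝ) else 0) + 1 / (T : ℝ) ^ 2 := by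
      intro s
      simp only [ha]
      split_ifs <;> field_simp <;> ring
    simp only [h, Finset.sum_add_distrib, Finset.sum_ite_eq', Finset.sum_const]
    simp
    field_simp
    ring
  have hsum4 : ∑ s, a s ^ 4 = ((T : ℝ) - 1) * ((T : ℝ) ^ 2 - 3 * T + 3) / (T : ℝ) ^ 3 := by
    have h : ∀ s, a s ^ 4 = (if s = t then (1 - 1 / (T : ℝ)) ^ 4 - 1 / (T : ℝ) ^ 4 else 0)
        + 1 / (T : ℝ) ^ 4 := by
      intro s
      simp only [ha]
      split_ifs <;> field_simp <;> ring
    simp only [h, Finset.sum_add_distrib, Finset.sum_ite_eq', Finset.sum_const]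
    simp
    field_simp
    ring
  have hmoment := (hindep'.moments_sum_of_centered (fun s => (hmeas s).const_mul (a s))
    (fun s => (hv s).const_mul (a s))
    (fun s => by rw [integral_const_mul, hmean, mul_zero]) Finset.univ).2.2
  simp only [mul_pow, integral_const_mul, hμ2, hμ4, ← Finset.sum_mul, ← pow_mul] at hmoment
  norm_num only at hmoment
  simp only [hresidual]
  rw [hmoment, hsum2, hsum4]
  field_simp
  ring
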